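/- (Exact improvement factor for the Row-Column pattern.) Let m, k, n ≥ 1, let H_m be a real m×m matrix with H_mᵀ*H_m = I and all entries of absolute value 1/√m, and H_n a real n×n matrix with H_nᵀ*H_n = I and all entries of absolute value 1/√n. Let A be a nonzero real m×k matrix supported on a single row and B a nonzero real k×n matrix supported on a single column. Then γ(H_m*A)·γ(B*H_n) = γ(A)·γ(B)/(m·n). That is, for the Row-Column pattern pair, the Outer Hadamard Transform reduces the product of outlier factors — and hence the √(γ(A)·γ(B)) factor in the quantization error bound — exactly by the factor √(m·n). -/

import Mathlib

open Matrix BigOperators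

/-- The Frobenius norm of a real matrix: `‖M‖_F = sqrt (∑ i j, (M i j)^2)`. -/
noncomputable def frob {m n : ℕ} (M : Matrix (Fin m) (Fin n) ℝ) : ℝ :=
  Real.sqrt (∑ i, ∑ j, (M i j) ^ 2)

/-- The maximum absolute value of an entry of a real matrix. -/
noncomputable def maxAbs {m n : ℕ} (M : Matrix (Fin m) (Fin n) ℝ) : ℝ :=
  ⨆ i, ⨆ j, |M i j|

/-- The outlier factor `γ(M) = m·n·(max_{i,j} |M_{ij}|)² / ‖M‖_F²` of a real
`m × n` matrix, measuring how concentrated its energy is in extreme values. -/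
noncomputable def outlierFactor {m n : ℕ} (M : Matrix (Fin m) (Fin n) ℝ) : ℝ :=
  (m * n : ℝ) * (maxAbs M) ^ 2 / (frob M) ^ 2

/-- A nonnegative family supported at a single index has supremum its value there. -/
theorem ciSup_eq_of_eq_zero_of_ne {ι : Type*} [Finite ι] (f : ι → ℝ) (a : ι)
    (ha : 0 ≤ f a) (h : ∀ i, i ≠ a → f i = 0) : ⨆ i, f i = f a := by
  have : Nonempty ι := ⟨a⟩
  refine le_antisymm (ciSup_le fun i => ?_) (le_ciSup (Set.finite_range f).bddAbove a)
  by_cases hi : i = a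
  · rw [hi]
  · rw [h i hi]
    exact ha

theorem frob_sq {m n : ℕ} (M : Matrix (Fin m) (Fin n) ℝ) :
    frob M ^ 2 = ∑ i, ∑ j, M i j ^ 2 :=
  Real.sq_sqrt (Finset.sum_nonneg fun _ _ => Finset.sum_nonneg fun _ _ => sq_nonneg _)

theorem sq_eq_inv_of_abs_eq_one_div_sqrt {x : ℝ} {m : ℕ} (h : |x| = 1 / Real.sqrt m) :
    x ^ 2 = (m : ℝ)⁻¹ := by
  rw [← sq_abs, h, div_pow, Real.sq_sqrt (Nat.cast_nonneg m), one_pow, one_div]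

/-- Left multiplication by a matrix with entries `±1/√m` divides the outlier factor of a
matrix supported on a single row by `m`. -/
theorem outlierFactor_mul_of_single_row {m k : ℕ} (H : Matrix (Fin m) (Fin m) ℝ)
    (hH : ∀ i p, |H i p| = 1 / Real.sqrt m) (A : Matrix (Fin m) (Fin k) ℝ)
    (r : Fin m) (hrow : ∀ i j, i ≠ r → A i j = 0) :
    outlierFactor (H * A) = outlierFactor A / m := by
  have : Nonempty (Fin m) := ⟨r⟩
  have hm : (m : ℝ) ≠ 0 := Nat.cast_ne_zero.mpr r.pos.ne'
  have hentry : ∀ i j, (H * A) i j = H i r * A r j := fun i j => by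
    rw [Matrix.mul_apply]
    exact Finset.sum_eq_single r (fun p _ hp => by rw [hrow p j hp, mul_zero]) (by simp)
  have hmaxA : maxAbs A = ⨆ j, |A r j| :=
    ciSup_eq_of_eq_zero_of_ne (fun i => ⨆ j, |A i j|) r (Real.iSup_nonneg fun _ => abs_nonneg _)
      fun i hi => by simp [hrow i _ hi]
  have hmax : maxAbs (H * A) = 1 / Real.sqrt m * maxAbs A := by
    rw [hmaxA, Real.mul_iSup_of_nonneg (by positivity)]
    simp only [maxAbs, hentry, abs_mul, hH, ciSup_const]
  have hfrobA : frob A ^ 2 = ∑ j, A r j ^ 2 := by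
    rw [frob_sq]
    exact Finset.sum_eq_single r (fun i _ hi => by simp [hrow i _ hi]) (by simp)
  have hfrob : frob (H * A) ^ 2 = frob A ^ 2 := by
    rw [hfrobA, frob_sq]
    simp only [hentry, mul_pow, sq_eq_inv_of_abs_eq_one_div_sqrt (hH _ _), ← Finset.mul_sum,
      Finset.sum_const, Finset.card_univ, Fintype.card_fin, nsmul_eq_mul]
    exact inv_mul_cancel_left₀ hm _
  rw [outlierFactor, outlierFactor, hfrob, hmax, mul_pow, div_pow,
    Real.sq_sqrt (Nat.cast_nonneg m)]
  ring

theorem frob_transpose {m n : ℕ} (M : Matrix (Fin m) (Fin n) ℝ) : frob Mᵀ = frob M := by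
  simp only [frob, Matrix.transpose_apply]
  rw [Finset.sum_comm]

theorem maxAbs_transpose_le {m n : ℕ} (M : Matrix (Fin m) (Fin n) ℝ) :
    maxAbs Mᵀ ≤ maxAbs M := by
  have hnonneg : 0 ≤ maxAbs M := Real.iSup_nonneg fun _ => Real.iSup_nonneg fun _ => abs_nonneg _
  refine Real.iSup_le (fun j => Real.iSup_le (fun i => ?_) hnonneg) hnonneg
  exact (le_ciSup (f := fun j => |M i j|) (Set.finite_range _).bddAbove j).trans
    (le_ciSup (f := fun i => ⨆ j, |M i j|) (Set.finite_range _).bddAbove i)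

theorem outlierFactor_transpose {m n : ℕ} (M : Matrix (Fin m) (Fin n) ℝ) :
    outlierFactor Mᵀ = outlierFactor M := by
  rw [outlierFactor, outlierFactor, frob_transpose,
    le_antisymm (maxAbs_transpose_le M) (maxAbs_transpose_le Mᵀ), mul_comm (n : ℝ)]

/-- Exact improvement factor for the Row-Column pattern. For a
single-row-supported `A` and single-column-supported `B`, the Outer Hadamard
Transform satisfies `γ(H_m*A)·γ(B*H_n) = γ(A)·γ(B)/(m·n)`, i.e. it reduces the
product of outlier factors exactly by the factor `m·n`. -/
theorem oht_rc_exact_improvement {m k n : ℕ} (hm : 1 ≤ m) (hk : 1 ≤ k) (hn : 1 ≤ n)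
    (Hm : Matrix (Fin m) (Fin m) ℝ) (hHm : Hmᵀ * Hm = 1)
    (hHme : ∀ i p, |Hm i p| = 1 / Real.sqrt m)
    (Hn : Matrix (Fin n) (Fin n) ℝ) (hHn : Hnᵀ * Hn = 1)
    (hHne : ∀ i p, |Hn i p| = 1 / Real.sqrt n)
    (A : Matrix (Fin m) (Fin k) ℝ) (hA : A ≠ 0)
    (r : Fin m) (hrow : ∀ i j, i ≠ r → A i j = 0)
    (B : Matrix (Fin k) (Fin n) ℝ) (hB : B ≠ 0)
    (c : Fin n) (hcol : ∀ i j, j ≠ c → B i j = 0) :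
    outlierFactor (Hm * A) * outlierFactor (B * Hn) =
      outlierFactor A * outlierFactor B / (m * n) := by
  have hright : outlierFactor (B * Hn) = outlierFactor B / n := by
    rw [← outlierFactor_transpose, Matrix.transpose_mul, ← outlierFactor_transpose B]
    exact outlierFactor_mul_of_single_row Hnᵀ (fun i p => hHne p i) Bᵀ c fun j i hj => hcol i j hj
  rw [outlierFactor_mul_of_single_row Hm hHme A r hrow, hright, div_mul_div_comm]
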